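/- Let G be a locally compact Hausdorff topological group with a Haar measure μ that is both left- and right-invariant (G unimodular), let k ≥ 1, let φ : G^k → ℂ be continuous, and let a₀,…,a_k : G → ℂ be compactly supported continuous functions. Define χ(φ)(a₀,…,a_k) := ∫_{G^k} a₀((g₁g₂⋯g_k)⁻¹) φ(g₁,…,g_k) a₁(g₁) ⋯ a_k(g_k) dμ(g₁)⋯dμ(g_k), and the cyclic operator τ_kφ(g₁,…,g_k) := φ((g₁⋯g_k)⁻¹, g₁,…,g_{k−1}). Then χ(τ_kφ)(a₀, a₁,…,a_k) = χ(φ)(a_k, a₀, a₁,…,a_{k−1}). -/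

import Mathlib

/-!
STATEMENT 9: Let G be a locally compact Hausdorff topological group with a
bi-invariant Haar measure μ, k ≥ 1, φ : G^k → ℂ continuous, and a₀,…,a_k
compactly supported continuous functions on G.  With
χ(φ)(a₀,…,a_k) := ∫_{G^k} a₀((g₁⋯g_k)⁻¹) φ(g₁,…,g_k) a₁(g₁)⋯a_k(g_k) dμ^k and
τ_kφ(g₁,…,g_k) := φ((g₁⋯g_k)⁻¹, g₁,…,g_{k−1}), one has
χ(τ_kφ)(a₀, a₁,…,a_k) = χ(φ)(a_k, a₀, a₁,…,a_{k−1}).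

G^k is modelled as `Fin k → G` with the product measure; the ordered product
g₁⋯g_k is `(List.ofFn g).prod`; k ≥ 1 is written k = m+1.
-/

open MeasureTheory

/-- χ(φ)(a₀,…,a_k) = ∫_{G^k} a₀((g₁⋯g_k)⁻¹) φ(g₁,…,g_k) a₁(g₁)⋯a_k(g_k) dμ(g₁)⋯dμ(g_k). -/
noncomputable def chiGroup {G : Type*} [Group G] [MeasurableSpace G]
    (μ : Measure G) (k : ℕ) (φ : (Fin k → G) → ℂ) (a : Fin (k + 1) → G → ℂ) : ℂ :=
  ∫ g : Fin k → G,
    a 0 ((List.ofFn g).prod)⁻¹ * φ g * ∏ i : Fin k, a i.succ (g i)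
    ∂(Measure.pi fun _ : Fin k => μ)

/-- The cyclic operator on k-tuples: (g₁,…,g_k) ↦ ((g₁⋯g_k)⁻¹, g₁,…,g_{k−1}). -/
def cyclicTuple {G : Type*} [Group G] {m : ℕ} (g : Fin (m + 1) → G) : Fin (m + 1) → G :=
  Fin.cons ((List.ofFn g).prod)⁻¹ (fun i : Fin m => g i.castSucc)

namespace ChiAux

/-- Real functions: invariance under inversion. -/
theorem integral_inv_real {G : Type*} [Group G] [TopologicalSpace G]
    [IsTopologicalGroup G] [T2Space G] [LocallyCompactSpace G]
    [MeasurableSpace G] [BorelSpace G]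
    (μ : Measure G) [μ.IsHaarMeasure] [μ.IsMulRightInvariant]
    (f : G → ℝ) (hf : Continuous f) (hs : HasCompactSupport f) :
    ∫ x, f x⁻¹ ∂μ = ∫ x, f x ∂μ := by
  have key : ∀ h : G → ℝ, Continuous h → HasCompactSupport h →
      ∫ x, h x⁻¹ ∂μ = (Measure.haarScalarFactor μ.inv μ : ℝ) * ∫ x, h x ∂μ := by
    intro h hc hh
    have h1 := Measure.integral_isMulLeftInvariant_eq_smul_of_hasCompactSupport μ.inv μ hc hh
    have h2 : ∫ x, h x ∂μ.inv = ∫ x, h x⁻¹ ∂μ :=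
      integral_map_equiv (MeasurableEquiv.inv G) h
    rw [← h2, h1, integral_smul_nnreal_measure]
    rfl
  obtain ⟨p, hp, hp0, hp1⟩ := exists_continuous_nonneg_pos (1 : G)
  have hpi : HasCompactSupport (fun x => p x⁻¹) := hp.comp_homeomorph (Homeomorph.inv G)
  have hq : HasCompactSupport (fun x => p x + p x⁻¹) := hp.add hpi
  have hqc : Continuous (fun x => p x + p x⁻¹) := by fun_prop
  have hpos : 0 < ∫ x, (p x + p x⁻¹) ∂μ :=
    hqc.integral_pos_of_hasCompactSupport_nonneg_nonzero hq
      (fun x => add_nonneg (hp0 x) (hp0 x⁻¹)) (x := 1) (by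
        have := hp0 1
        simp only [inv_one]
        intro h
        apply hp1
        linarith)
  have h3 := key _ hqc hq
  have h4 : ∫ x, (p x⁻¹ + p x⁻¹⁻¹) ∂μ = ∫ x, (p x + p x⁻¹) ∂μ := by
    congr 1; ext x; rw [inv_inv, add_comm]
  rw [h4] at h3
  have h5 : (Measure.haarScalarFactor μ.inv μ : ℝ) = 1 := by
    have : ((Measure.haarScalarFactor μ.inv μ : ℝ) - 1) * ∫ x, (p x + p x⁻¹) ∂μ = 0 := by
      linarith
    rcases mul_eq_zero.1 this with h | h
    · linarith
    · exact absurd h hpos.ne'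
  rw [key f hf hs, h5, one_mul]

theorem integral_inv_complex {G : Type*} [Group G] [TopologicalSpace G]
    [IsTopologicalGroup G] [T2Space G] [LocallyCompactSpace G]
    [MeasurableSpace G] [BorelSpace G]
    (μ : Measure G) [μ.IsHaarMeasure] [μ.IsMulRightInvariant]
    (f : G → ℂ) (hf : Continuous f) (hs : HasCompactSupport f) :
    ∫ x, f x⁻¹ ∂μ = ∫ x, f x ∂μ := by
  have hi : Integrable f μ := hf.integrable_of_hasCompactSupport hs
  have hi' : Integrable (fun x => f x⁻¹) μ :=
    (hf.comp continuous_inv).integrable_of_hasCompactSupport (hs.comp_homeomorph (Homeomorph.inv G))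
  rw [← integral_re_add_im hi, ← integral_re_add_im hi']
  have h1 := integral_inv_real μ (fun x => RCLike.re (f x)) (RCLike.continuous_re.comp hf)
    (hs.comp_left (g := fun z : ℂ => RCLike.re z) (by simp))
  have h2 := integral_inv_real μ (fun x => RCLike.im (f x)) (RCLike.continuous_im.comp hf)
    (hs.comp_left (g := fun z : ℂ => RCLike.im z) (by simp))
  rw [h1, h2]

/-- Separation of a compact set from the complement of an open set by a product-measurable set. -/
theorem exists_meas {G : Type*} [TopologicalSpace G] [MeasurableSpace G] [BorelSpace G]
    {n : ℕ} {C V : Set (Fin n → G)} (hC : IsCompact C) (hV : IsOpen V) (hCV : C ⊆ V) :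
    ∃ M : Set (Fin n → G), MeasurableSet M ∧ C ⊆ M ∧ M ⊆ V := by
  refine hC.induction_on (p := fun s => ∃ M : Set (Fin n → G), MeasurableSet M ∧ s ⊆ M ∧ M ⊆ V)
    ⟨∅, MeasurableSet.empty, le_rfl, Set.empty_subset _⟩ ?_ ?_ ?_
  · rintro s t hst ⟨M, h1, h2, h3⟩
    exact ⟨M, h1, hst.trans h2, h3⟩
  · rintro s t ⟨M, h1, h2, h3⟩ ⟨N, k1, k2, k3⟩
    exact ⟨M ∪ N, h1.union k1, Set.union_subset_union h2 k2, Set.union_subset h3 k3⟩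
  · intro x hx
    obtain ⟨u, hu, huV⟩ := isOpen_pi_iff'.1 hV x (hCV hx)
    refine ⟨Set.univ.pi u, ?_, Set.univ.pi u, ?_, le_rfl, huV⟩
    · exact mem_nhdsWithin_of_mem_nhds
        ((isOpen_set_pi Set.finite_univ fun i _ => (hu i).1).mem_nhds fun i _ => (hu i).2)
    · exact MeasurableSet.pi Set.countable_univ fun i _ => (hu i).1.measurableSet

theorem measurable_aux {G : Type*} [TopologicalSpace G] [T2Space G]
    [MeasurableSpace G] [BorelSpace G] {n : ℕ} {K : Set G} (hK : IsCompact K)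
    (F : (Fin n → G) → ℂ) (hF : Continuous F)
    (h0 : ∀ g, g ∉ Set.univ.pi (fun _ : Fin n => K) → F g = 0) : Measurable F := by
  have hB : IsCompact (Set.univ.pi (fun _ : Fin n => K)) := isCompact_univ_pi fun _ => hK
  have hBm : MeasurableSet (Set.univ.pi (fun _ : Fin n => K)) :=
    MeasurableSet.pi Set.countable_univ fun _ _ => hK.isClosed.measurableSet
  set B := Set.univ.pi (fun _ : Fin n => K) with hBdef
  refine measurable_of_isOpen fun U hU => ?_
  obtain ⟨C, hCc, hCU, hCe, -⟩ := hU.exists_iUnion_isClosed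
  have hm : ∀ j, ∃ M : Set (Fin n → G), MeasurableSet M ∧ B ∩ F ⁻¹' (C j) ⊆ M ∧ M ⊆ F ⁻¹' U :=
    fun j => exists_meas (hB.inter_right ((hCc j).preimage hF)) (hU.preimage hF)
      (fun x hx => hCU j hx.2)
  choose M hM1 hM2 hM3 using hm
  have e1 : F ⁻¹' U ∩ B = (⋃ j, M j) ∩ B := by
    ext x
    constructor
    · rintro ⟨hx, hxB⟩
      refine ⟨?_, hxB⟩
      have : F x ∈ ⋃ j, C j := by rw [hCe]; exact hx
      obtain ⟨j, hj⟩ := Set.mem_iUnion.1 this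
      exact Set.mem_iUnion.2 ⟨j, hM2 j ⟨hxB, hj⟩⟩
    · rintro ⟨hx, hxB⟩
      obtain ⟨j, hj⟩ := Set.mem_iUnion.1 hx
      exact ⟨hM3 j hj, hxB⟩
  have m1 : MeasurableSet (F ⁻¹' U ∩ B) := by
    rw [e1]; exact (MeasurableSet.iUnion hM1).inter hBm
  by_cases hz : (0 : ℂ) ∈ U
  · have : F ⁻¹' U = (F ⁻¹' U ∩ B) ∪ Bᶜ := by
      ext x
      by_cases hx : x ∈ B
      · simp [hx]
      · simp [hx, h0 x hx, hz]
    rw [this]; exact m1.union hBm.compl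
  · have : F ⁻¹' U = F ⁻¹' U ∩ B := by
      ext x
      by_cases hx : x ∈ B
      · simp [hx]
      · simp [hx, h0 x hx, hz]
    rw [this]; exact m1

theorem pi_restrict_aux {G : Type*} [MeasurableSpace G] (μ : Measure G) {K : Set G}
    (hK : MeasurableSet K) (hfin : μ K ≠ ⊤) (n : ℕ) :
    (Measure.pi fun _ : Fin n => μ).restrict (Set.univ.pi fun _ => K)
      = Measure.pi fun _ : Fin n => μ.restrict K := by
  have : IsFiniteMeasure (μ.restrict K) := ⟨by simpa using hfin.lt_top⟩
  have hBm : MeasurableSet (Set.univ.pi (fun _ : Fin n => K)) :=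
    MeasurableSet.pi Set.countable_univ fun _ _ => hK
  have hle : (Measure.pi fun _ : Fin n => μ.restrict K).toOuterMeasure ≤
      OuterMeasure.pi fun _ : Fin n => μ.toOuterMeasure := by
    rw [OuterMeasure.le_pi]
    intro s _
    change (Measure.pi fun _ : Fin n => μ.restrict K) _ ≤ _
    rw [Measure.pi_pi]
    exact Finset.prod_le_prod' fun i _ => Measure.restrict_apply_le _ _
  have hν : (Measure.pi fun _ : Fin n => μ.restrict K) (Set.univ.pi fun _ => K) = 
      (Measure.pi fun _ : Fin n => μ.restrict K) Set.univ := by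
    rw [← Set.pi_univ Set.univ, Measure.pi_pi, Measure.pi_pi]; simp
  have hle2 : (Measure.pi fun _ : Fin n => μ.restrict K) ≤
      (Measure.pi fun _ : Fin n => μ).restrict (Set.univ.pi fun _ => K) := by
    refine Measure.le_iff.2 fun s hs => ?_
    rw [Measure.restrict_apply hs]
    have hc : (Measure.pi fun _ : Fin n => μ.restrict K) (Set.univ.pi fun _ => K)ᶜ = 0 := by
      rw [measure_compl hBm (measure_ne_top _ _), hν, tsub_self]
    rw [← measure_inter_conull hc]
    conv_rhs => rw [Measure.pi, toMeasure_apply _ _ (hs.inter hBm)]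
    exact hle _
  refine (Measure.eq_of_le_of_measure_univ_eq hle2 (le_antisymm (hle2 _) ?_)).symm
  rw [Measure.restrict_apply MeasurableSet.univ, Set.univ_inter, ← hν,
    Measure.pi_pi (fun _ : Fin n => μ.restrict K)]
  conv_lhs => rw [Measure.pi, toMeasure_apply _ _ hBm]
  refine (OuterMeasure.pi_pi_le _ _).trans ?_
  simp

theorem fubini_aux {G : Type*} [TopologicalSpace G] [T2Space G]
    [MeasurableSpace G] [BorelSpace G] (μ : Measure G) [IsFiniteMeasureOnCompacts μ]
    {n : ℕ} {K : Set G} (hK : IsCompact K)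
    (F : (Fin (n + 1) → G) → ℂ) (hF : Continuous F)
    (h0 : ∀ g i, g i ∉ K → F g = 0) (i : Fin (n + 1)) :
    ∫ g, F g ∂(Measure.pi fun _ : Fin (n + 1) => μ)
      = ∫ g : Fin n → G, ∫ x, F (i.insertNth x g) ∂μ
          ∂(Measure.pi fun _ : Fin n => μ.restrict K) := by
  have : IsFiniteMeasure (μ.restrict K) := ⟨by simpa using hK.measure_lt_top⟩
  have h0' : ∀ g, g ∉ Set.univ.pi (fun _ : Fin (n + 1) => K) → F g = 0 := by
    intro g hg
    simp only [Set.mem_pi, Set.mem_univ, true_imp_iff, not_forall] at hg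
    obtain ⟨j, hj⟩ := hg
    exact h0 g j hj
  have hmeas := measurable_aux hK F hF h0'
  have hB : IsCompact (Set.univ.pi (fun _ : Fin (n + 1) => K)) := isCompact_univ_pi fun _ => hK
  obtain ⟨c, hc⟩ := hB.exists_bound_of_continuousOn hF.continuousOn
  have hint : Integrable F (Measure.pi fun _ : Fin (n + 1) => μ.restrict K) := by
    refine Integrable.of_bound hmeas.aestronglyMeasurable (max c 0) (Filter.Eventually.of_forall ?_)
    intro g
    by_cases hg : g ∈ Set.univ.pi (fun _ : Fin (n + 1) => K)
    · exact (hc g hg).trans (le_max_left _ _)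
    · rw [h0' g hg]; simp
  rw [← setIntegral_eq_integral_of_forall_compl_eq_zero h0',
    pi_restrict_aux μ hK.isClosed.measurableSet hK.measure_lt_top.ne]
  have mp := (measurePreserving_piFinSuccAbove (fun _ : Fin (n + 1) => μ.restrict K) i).symm
  rw [← mp.integral_comp' F]
  have hint2 := (mp.integrable_comp_emb (MeasurableEquiv.measurableEmbedding _)).2 hint
  refine (integral_prod_symm _ hint2).trans ?_
  congr 1
  ext g
  change ∫ x in K, F (i.insertNth x g) ∂μ = _
  refine setIntegral_eq_integral_of_forall_compl_eq_zero fun x hx => h0 _ i ?_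
  simpa using hx

end ChiAux

theorem chiGroup_cyclic {G : Type*} [Group G] [TopologicalSpace G]
    [IsTopologicalGroup G] [T2Space G] [LocallyCompactSpace G]
    [MeasurableSpace G] [BorelSpace G]
    (μ : Measure G) [μ.IsHaarMeasure] [μ.IsMulRightInvariant]
    (m : ℕ) (φ : (Fin (m + 1) → G) → ℂ) (hφ : Continuous φ)
    (a : Fin (m + 2) → G → ℂ)
    (hac : ∀ i, Continuous (a i)) (has : ∀ i, HasCompactSupport (a i)) :
    chiGroup μ (m + 1) (fun g => φ (cyclicTuple g)) a
      = chiGroup μ (m + 1) φ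
          (Fin.cons (a (Fin.last (m + 1))) (fun i : Fin (m + 1) => a i.castSucc)) := by
  have hK : IsCompact (⋃ i, tsupport (a i)) := isCompact_iUnion has
  have hz : ∀ i x, x ∉ (⋃ i, tsupport (a i)) → a i x = 0 := fun i x hx =>
    image_eq_zero_of_notMem_tsupport fun h => hx (Set.mem_iUnion.2 ⟨i, h⟩)
  set K := ⋃ i, tsupport (a i)
  have hprod : Continuous fun g : Fin (m + 1) → G => (List.ofFn g).prod := by
    simp only [List.ofFn_eq_map]
    exact continuous_list_prod _ fun i _ => continuous_apply i
  have hcyc : Continuous fun g : Fin (m + 1) → G => cyclicTuple g := by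
    refine continuous_pi fun i => ?_
    refine Fin.cases ?_ (fun j => ?_) i
    · exact hprod.inv
    · simpa [cyclicTuple] using continuous_apply j.castSucc
  unfold chiGroup
  simp only [Fin.cons_zero, Fin.cons_succ]
  have cL : Continuous fun g : Fin (m + 1) → G =>
      a 0 ((List.ofFn g).prod)⁻¹ * φ (cyclicTuple g) * ∏ i : Fin (m + 1), a i.succ (g i) :=
    (((hac 0).comp hprod.inv).mul (hφ.comp hcyc)).mul
      (continuous_finsetProd _ fun i _ => (hac _).comp (continuous_apply i))
  have cR : Continuous fun g : Fin (m + 1) → G =>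
      a (Fin.last (m + 1)) ((List.ofFn g).prod)⁻¹ * φ g
        * ∏ i : Fin (m + 1), a i.castSucc (g i) :=
    (((hac _).comp hprod.inv).mul hφ).mul
      (continuous_finsetProd _ fun i _ => (hac _).comp (continuous_apply i))
  rw [ChiAux.fubini_aux μ hK _ cL (fun g i hi => by
      rw [Finset.prod_eq_zero (Finset.mem_univ i) (hz _ _ hi), mul_zero]) (Fin.last m),
    ChiAux.fubini_aux μ hK _ cR (fun g i hi => by
      rw [Finset.prod_eq_zero (Finset.mem_univ i) (hz _ _ hi), mul_zero]) 0]
  congr 1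
  ext g
  set f : G → ℂ := fun y => a (Fin.last (m + 1)) ((List.ofFn (Fin.insertNth (α := fun _ => G) 0 y g)).prod)⁻¹
      * φ (Fin.insertNth (α := fun _ => G) 0 y g)
      * ∏ i : Fin (m + 1), a i.castSucc (Fin.insertNth (α := fun _ => G) 0 y g i) with hf
  have fc : Continuous f := by
    refine cR.comp (f := fun y => Fin.insertNth (α := fun _ => G) 0 y g) ?_
    refine continuous_pi fun i => ?_
    refine Fin.cases ?_ (fun j => ?_) i
    · exact continuous_id
    · simpa using continuous_const
  have fs : HasCompactSupport f := by
    refine HasCompactSupport.intro hK fun x hx => ?_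
    rw [hf]
    simp only
    rw [Finset.prod_eq_zero (Finset.mem_univ (0 : Fin (m + 1)))
      (hz (0 : Fin (m + 1)).castSucc _ (by simpa using hx)), mul_zero]
  rw [← ChiAux.integral_inv_complex μ f fc fs,
    ← integral_mul_left_eq_self (fun x => f x⁻¹) (List.ofFn g).prod]
  congr 1
  ext x
  have e1 : (List.ofFn (Fin.snoc (α := fun _ => G) g x)).prod = (List.ofFn g).prod * x := by
    rw [List.ofFn_succ']; simp
  have e2 : cyclicTuple (Fin.snoc (α := fun _ => G) g x)
      = Fin.cons (α := fun _ => G) ((List.ofFn g).prod * x)⁻¹ g := by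
    unfold cyclicTuple
    rw [e1]; simp
  have e3 : ∀ y : G, (List.ofFn (Fin.cons (α := fun _ => G) y g)).prod = y * (List.ofFn g).prod := by
    intro y
    rw [List.ofFn_succ]; simp
  simp only [hf, Fin.insertNth_zero', Fin.insertNth_last', e1, e2, e3]
  rw [Fin.prod_univ_castSucc, Fin.prod_univ_succ]
  simp only [Fin.snoc_castSucc, Fin.snoc_last, Fin.cons_zero, Fin.cons_succ, Fin.succ_last,
    Fin.castSucc_zero, Fin.succ_castSucc]
  have e4 : (((List.ofFn g).prod * x)⁻¹ * (List.ofFn g).prod)⁻¹ = x := by group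
  rw [e4]
  ring
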